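/- arXiv:2504.12918 — 4 statements merged into one kernel-verified Lean document; each statement's English description precedes it below -/
import Mathlib

section
/- Let E be a real normed vector space, let z_1, …, z_N ∈ E with N ≥ 2, and fix indices k ≠ l in {1, …, N}. Then for every bijection σ from the index set {1, …, N} \ {k} onto the index set {1, …, N} \ {l}, one has Σ_{i ∈ {1,…,N}\{k}} ‖z_i − z_{σ(i)}‖ ≥ ‖z_k − z_l‖. (This is the key chain/triangle-inequality step, equation (3), in the proof of Lemma 1: any matching of the two point families that differ in one point must pay at least the cost of transporting z_l to z_k.) -/
/-- Chain/triangle-inequality step (equation (3) in the proof of Lemma 1):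
for points `z_1, …, z_N` in a real normed vector space, indices `k ≠ l`, and any
bijection `σ` from the index set `{1,…,N} \ {k}` onto `{1,…,N} \ {l}`, the total
matching cost `Σ_{i ≠ k} ‖z_i − z_{σ i}‖` is at least `‖z_k − z_l‖`. -/
theorem single_sample_transport_lower_bound
    {E : Type*} [NormedAddCommGroup E] [NormedSpace ℝ E]
    (N : ℕ) (hN : 2 ≤ N) (z : Fin N → E) (k l : Fin N) (hkl : k ≠ l)
    (σ : {i : Fin N // i ≠ k} ≃ {i : Fin N // i ≠ l}) :
    ‖z k - z l‖ ≤ ∑ i : {i : Fin N // i ≠ k}, ‖z i.1 - z (σ i).1‖ := by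
  have hsum : ∑ i : {i : Fin N // i ≠ k}, (z i.1 - z (σ i).1) = z l - z k := by
    have hk := Fintype.sum_eq_add_sum_subtype_ne z k
    have hl := Fintype.sum_eq_add_sum_subtype_ne z l
    rw [Finset.sum_sub_distrib, Equiv.sum_comp σ (fun j => z j.1),
      sub_eq_sub_iff_add_eq_add, add_comm, ← hk, hl]
  rw [norm_sub_rev, ← hsum]
  exact norm_sum_le _ _
end

section
/- Let E be a real normed vector space, let z_1, …, z_N ∈ E with N ≥ 2, and fix indices k ≠ l in {1, …, N}. Then the minimum over all bijections σ from {1, …, N} \ {k} onto {1, …, N} \ {l} of (1/(N−1)) Σ_{i ∈ {1,…,N}\{k}} ‖z_i − z_{σ(i)}‖ equals ‖z_k − z_l‖ / (N−1). Equivalently (Lemma 1 of the paper), the order-1 Wasserstein distance between the empirical measures \hat P_{N−1}^{−z_k} and \hat P_{N−1}^{−z_l} equals the single-sample transport cost ‖z_k − z_l‖ / (N−1): the optimal plan sends z_l to z_k and leaves every other sample fixed. -/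
/-- The total displacement of a bijection between the complements of two points
does not depend on the bijection. -/
theorem sum_sub_equiv_compl_singleton {ι M : Type*} [Fintype ι] [DecidableEq ι]
    [AddCommGroup M] (z : ι → M) (k l : ι) (σ : {i : ι // i ≠ k} ≃ {i : ι // i ≠ l}) :
    ∑ i : {i : ι // i ≠ k}, (z i.1 - z (σ i).1) = z l - z k := by
  have hk := Fintype.sum_eq_add_sum_subtype_ne z k
  have hl := Fintype.sum_eq_add_sum_subtype_ne z l
  rw [Finset.sum_sub_distrib, σ.sum_comp (fun j => z j.1), sub_eq_sub_iff_add_eq_add,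
    add_comm, ← hk, hl]

/-- Transporting along the transposition of `k` and `l` costs exactly `‖z k - z l‖`. -/
theorem sum_norm_sub_swap {ι E : Type*} [Fintype ι] [DecidableEq ι]
    [SeminormedAddCommGroup E] (z : ι → E) {k l : ι} (hkl : k ≠ l) :
    ∑ i : {i : ι // i ≠ k}, ‖z i.1 - z (Equiv.swap k l i.1)‖ = ‖z k - z l‖ := by
  rw [Fintype.sum_eq_single ⟨l, hkl.symm⟩]
  · simp [norm_sub_rev]
  · rintro ⟨i, hi⟩ hil
    have hil' : i ≠ l := fun h => hil (Subtype.ext h)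
    simp [Equiv.swap_apply_of_ne_of_ne hi hil']

/-- Lemma 1: the order-1 Wasserstein distance between the one-sample-removed
empirical measures, expressed as the minimum over bijections
`σ : {1,…,N} \ {k} ≃ {1,…,N} \ {l}` of `(1/(N−1)) Σ_{i ≠ k} ‖z_i − z_{σ i}‖`,
equals the single-sample transport cost `‖z_k − z_l‖ / (N−1)`. -/
theorem wasserstein_one_single_sample_transport
    {E : Type*} [NormedAddCommGroup E] [NormedSpace ℝ E]
    (N : ℕ) (hN : 2 ≤ N) (z : Fin N → E) (k l : Fin N) (hkl : k ≠ l) :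
    (⨅ σ : {i : Fin N // i ≠ k} ≃ {i : Fin N // i ≠ l},
        (1 / ((N : ℝ) - 1)) * ∑ i : {i : Fin N // i ≠ k}, ‖z i.1 - z (σ i).1‖)
      = ‖z k - z l‖ / ((N : ℝ) - 1) := by
  have hN' : (0 : ℝ) ≤ 1 / ((N : ℝ) - 1) := by
    have : (2 : ℝ) ≤ N := by exact_mod_cast hN
    exact one_div_nonneg.2 (by linarith)
  let τ : {i : Fin N // i ≠ k} ≃ {i : Fin N // i ≠ l} :=
    (Equiv.swap k l).subtypeEquiv fun i => by
      rw [ne_eq, ne_eq, Equiv.swap_apply_eq_iff, Equiv.swap_apply_right]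
  have lower (σ : {i : Fin N // i ≠ k} ≃ {i : Fin N // i ≠ l}) :
      ‖z k - z l‖ ≤ ∑ i : {i : Fin N // i ≠ k}, ‖z i.1 - z (σ i).1‖ := by
    rw [norm_sub_rev, ← sum_sub_equiv_compl_singleton z k l σ]
    exact norm_sum_le _ _
  rw [← one_div_mul_eq_div _ ‖z k - z l‖]
  refine IsLeast.csInf_eq ⟨⟨τ, ?_⟩, ?_⟩
  · exact congrArg (1 / ((N : ℝ) - 1) * ·) (sum_norm_sub_swap z hkl)
  · rintro _ ⟨σ, rfl⟩
    exact mul_le_mul_of_nonneg_left (lower σ) hN'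
end

section
/- Let E be a real normed vector space, let z_1, …, z_N ∈ E with N ≥ 2, fix indices k ≠ l in {1, …, N}, and let t ≥ 1 be a real number. Then ‖z_k − z_l‖ / (N−1) ≤ ( min over bijections σ from {1, …, N} \ {k} onto {1, …, N} \ {l} of (1/(N−1)) Σ_{i ∈ {1,…,N}\{k}} ‖z_i − z_{σ(i)}‖^t )^{1/t}. (This is the lower bound of Proposition 1: the order-t Wasserstein distance between the one-sample-removed empirical measures is at least the order-1 distance ‖z_k − z_l‖/(N−1), by combining Lemma 1 with the monotonicity of the Wasserstein distance in its order.) -/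
/-- Removing one point from each of two copies of a finite family: the total displacement of any
matching of the remaining points is the difference of the removed points. -/
lemma sum_sub_comp_equiv_subtype_ne {ι E : Type*} [Fintype ι] [DecidableEq ι] [AddCommGroup E]
    (z : ι → E) (k l : ι) (σ : {i : ι // i ≠ k} ≃ {i : ι // i ≠ l}) :
    ∑ i : {i : ι // i ≠ k}, (z i.1 - z (σ i).1) = z l - z k := by
  rw [Finset.sum_sub_distrib, Equiv.sum_comp σ (fun j => z j.1),
    sub_eq_sub_iff_add_eq_add, add_comm, ← Fintype.sum_eq_add_sum_subtype_ne z k,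
    ← Fintype.sum_eq_add_sum_subtype_ne z l]

/-- Lower bound of Proposition 1: the order-`t` Wasserstein distance between the
one-sample-removed empirical measures is at least `‖z_k − z_l‖ / (N−1)`. -/
theorem wasserstein_t_single_sample_lower_bound
    {E : Type*} [NormedAddCommGroup E] [NormedSpace ℝ E]
    (N : ℕ) (hN : 2 ≤ N) (z : Fin N → E) (k l : Fin N) (hkl : k ≠ l)
    (t : ℝ) (ht : 1 ≤ t) :
    ‖z k - z l‖ / ((N : ℝ) - 1)
      ≤ (⨅ σ : {i : Fin N // i ≠ k} ≃ {i : Fin N // i ≠ l},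
          (1 / ((N : ℝ) - 1)) * ∑ i : {i : Fin N // i ≠ k}, ‖z i.1 - z (σ i).1‖ ^ t)
          ^ (1 / t) := by
  have hN1 : (0 : ℝ) < (N : ℝ) - 1 := by
    have : (2 : ℝ) ≤ N := by exact_mod_cast hN
    linarith
  have hcard : (Fintype.card {i : Fin N // i ≠ k} : ℝ) = (N : ℝ) - 1 := by
    have h : Fintype.card {i : Fin N // i ≠ k} = N - 1 := by
      simp [Fintype.card_subtype_compl]
    rw [h, Nat.cast_sub (by omega), Nat.cast_one]
  have : Nonempty ({i : Fin N // i ≠ k} ≃ {i : Fin N // i ≠ l}) :=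
    ⟨(Equiv.swap k l).subtypeEquiv fun i => by
      rw [ne_eq, ne_eq, Equiv.swap_apply_eq_iff, Equiv.swap_apply_right]⟩
  rw [one_div t, Real.le_rpow_inv_iff_of_pos (by positivity)
    (Real.iInf_nonneg fun σ => by positivity) (by linarith)]
  refine le_ciInf fun σ => ?_
  calc (‖z k - z l‖ / ((N : ℝ) - 1)) ^ t
      ≤ (∑ i : {i : Fin N // i ≠ k}, (1 / ((N : ℝ) - 1)) * ‖z i.1 - z (σ i).1‖) ^ t := by
        refine Real.rpow_le_rpow (by positivity) ?_ (by linarith)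
        rw [← Finset.mul_sum, div_eq_inv_mul, one_div, norm_sub_rev,
          ← sum_sub_comp_equiv_subtype_ne z k l σ]
        gcongr
        exact norm_sum_le _ _
    _ ≤ ∑ i : {i : Fin N // i ≠ k}, (1 / ((N : ℝ) - 1)) * ‖z i.1 - z (σ i).1‖ ^ t := by
        refine Real.rpow_arith_mean_le_arith_mean_rpow _ _ _ (fun _ _ => by positivity) ?_
          (fun _ _ => norm_nonneg _) ht
        rw [Finset.sum_const, Finset.card_univ, nsmul_eq_mul, hcard, mul_one_div_cancel hN1.ne']
    _ = _ := (Finset.mul_sum _ _ _).symm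
end

section
/- (Proposition 1.) Let E be a real normed vector space, let z_1, …, z_N ∈ E with N ≥ 2, fix indices k ≠ l in {1, …, N}, and let 1 ≤ t < ∞ be a real number. Writing W_t := ( min over bijections σ from {1, …, N} \ {k} onto {1, …, N} \ {l} of (1/(N−1)) Σ_{i ∈ {1,…,N}\{k}} ‖z_i − z_{σ(i)}‖^t )^{1/t} for the order-t Wasserstein distance between the empirical measures \hat P_{N−1}^{−z_k} and \hat P_{N−1}^{−z_l}, one has the two-sided bound ‖z_k − z_l‖ / (N−1) ≤ W_t ≤ ‖z_k − z_l‖ / (N−1)^{1/t}. -/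
/-- The differences along a bijection between the complements of `k` and `l` sum to
`z l - z k`. -/
theorem sum_sub_compl_equiv {ι E : Type*} [Fintype ι] [DecidableEq ι] [AddCommGroup E]
    (z : ι → E) {k l : ι} (σ : {i : ι // i ≠ k} ≃ {i : ι // i ≠ l}) :
    ∑ i : {i : ι // i ≠ k}, (z i.1 - z (σ i).1) = z l - z k := by
  have h (j : ι) : z j + ∑ i : {i : ι // i ≠ j}, z i.1 = ∑ i, z i :=
    (Fintype.sum_eq_add_sum_subtype_ne z j).symm
  rw [Finset.sum_sub_distrib, Equiv.sum_comp σ fun i ↦ z i.1, eq_sub_of_add_eq' (h k),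
    eq_sub_of_add_eq' (h l)]
  abel

/-- The transposition of `k` and `l`, as a bijection from the complement of `k` to that of `l`. -/
def swapCompl {ι : Type*} [DecidableEq ι] (k l : ι) : {i : ι // i ≠ k} ≃ {i : ι // i ≠ l} :=
  (Equiv.swap k l).subtypeEquiv fun i ↦ by
    rw [Ne, Ne, Equiv.swap_apply_eq_iff, Equiv.swap_apply_right]

theorem sum_norm_sub_swapCompl_rpow {ι E : Type*} [Fintype ι] [DecidableEq ι]
    [SeminormedAddCommGroup E] (z : ι → E) {k l : ι} (hkl : k ≠ l) {t : ℝ} (ht : t ≠ 0) :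
    ∑ i : {i : ι // i ≠ k}, ‖z i.1 - z (swapCompl k l i).1‖ ^ t = ‖z k - z l‖ ^ t := by
  rw [Fintype.sum_eq_single ⟨l, hkl.symm⟩]
  · simp [swapCompl, norm_sub_rev]
  · rintro ⟨i, hik⟩ hil
    have hil : i ≠ l := fun h ↦ hil (Subtype.ext h)
    simp [swapCompl, Equiv.swap_apply_of_ne_of_ne hik hil, Real.zero_rpow ht]

/-- Proposition 1: with
`W_t = (min_σ (1/(N−1)) Σ_{i ≠ k} ‖z_i − z_{σ i}‖^t)^{1/t}` the order-`t`
Wasserstein distance between the one-sample-removed empirical measures,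
one has `‖z_k − z_l‖/(N−1) ≤ W_t ≤ ‖z_k − z_l‖/(N−1)^{1/t}`. -/
theorem wasserstein_t_single_sample_two_sided_bound
    {E : Type*} [NormedAddCommGroup E] [NormedSpace ℝ E]
    (N : ℕ) (hN : 2 ≤ N) (z : Fin N → E) (k l : Fin N) (hkl : k ≠ l)
    (t : ℝ) (ht : 1 ≤ t) :
    ‖z k - z l‖ / ((N : ℝ) - 1)
      ≤ (⨅ σ : {i : Fin N // i ≠ k} ≃ {i : Fin N // i ≠ l},
          (1 / ((N : ℝ) - 1)) * ∑ i : {i : Fin N // i ≠ k}, ‖z i.1 - z (σ i).1‖ ^ t)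
          ^ (1 / t) ∧
    (⨅ σ : {i : Fin N // i ≠ k} ≃ {i : Fin N // i ≠ l},
        (1 / ((N : ℝ) - 1)) * ∑ i : {i : Fin N // i ≠ k}, ‖z i.1 - z (σ i).1‖ ^ t)
        ^ (1 / t)
      ≤ ‖z k - z l‖ / ((N : ℝ) - 1) ^ (1 / t) := by
  have hM : (0 : ℝ) < (N : ℝ) - 1 := by
    have : (2 : ℝ) ≤ N := by exact_mod_cast hN
    linarith
  have ht0 : 0 < t := by linarith
  have : Nonempty ({i : Fin N // i ≠ k} ≃ {i : Fin N // i ≠ l}) := ⟨swapCompl k l⟩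
  constructor
  · rw [one_div t, Real.le_rpow_inv_iff_of_pos (by positivity)
      (Real.iInf_nonneg fun σ ↦ by positivity) ht0]
    refine le_ciInf fun σ ↦ ?_
    have hcard : ∑ _i : {i : Fin N // i ≠ k}, 1 / ((N : ℝ) - 1) = 1 := by
      have : ((N - 1 : ℕ) : ℝ) = N - 1 := by push_cast [show 1 ≤ N by lia]; rfl
      simp [Fintype.card_subtype_compl, this, hM.ne']
    calc (‖z k - z l‖ / ((N : ℝ) - 1)) ^ t
        ≤ (∑ i : {i : Fin N // i ≠ k}, 1 / ((N : ℝ) - 1) * ‖z i.1 - z (σ i).1‖) ^ t := by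
          gcongr
          rw [← Finset.mul_sum, div_eq_inv_mul, ← one_div, norm_sub_rev,
            ← sum_sub_compl_equiv z σ]
          gcongr
          exact norm_sum_le _ _
      _ ≤ ∑ i : {i : Fin N // i ≠ k}, 1 / ((N : ℝ) - 1) * ‖z i.1 - z (σ i).1‖ ^ t :=
          Real.rpow_arith_mean_le_arith_mean_rpow _ _ _ (fun _ _ ↦ by positivity) hcard
            (fun _ _ ↦ norm_nonneg _) ht
      _ = _ := (Finset.mul_sum ..).symm
  · rw [one_div t, Real.rpow_inv_le_iff_of_pos (Real.iInf_nonneg fun σ ↦ by positivity)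
      (by positivity) ht0, Real.div_rpow (norm_nonneg _) (by positivity),
      Real.rpow_inv_rpow hM.le ht0.ne']
    refine (ciInf_le (Set.finite_range _).bddBelow (swapCompl k l)).trans_eq ?_
    rw [sum_norm_sub_swapCompl_rpow z hkl ht0.ne', one_div_mul_eq_div]
end
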